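/- Fix β > 0. If ν₁ is a probability measure on ℝ solving the Dawson equation at parameter σ, then the product measure ν(dx,dy) = (e^{−y²/σ²}/√(πσ²))ν₁(dx)dy solves the kinetic fixed-point equation ν(dx,dy) = exp{−(2/σ²)(y²/2 + x⁴/4 − x²/2) − (β/σ²)∫(x−z)²ν₁(dz)}dx dy / (normalizing integral), where ν₁ is the first marginal. Moreover, if σ0 > 0 satisfies 1 = (2β/σ0²)∫x²ν_{σ0}(dx) with ν_{σ0}(dx) = exp{−(2/σ0²)(x⁴/4 − x²/2 + (β/2)x²)}dx/(normalizer), then σ0 ∈ [√(2β/3), √(2β)] and σ0 is a bifurcation point of the kinetic equation: for every δ′ > 0 there exist σ ∈ (σ0−δ′, σ0+δ′) and a probability measure μ on ℝ² solving the kinetic equation at σ with μ different from the product solution at σ. -/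

import Mathlib

open MeasureTheory Real Set Filter Topology ENNReal NNReal

noncomputable section

namespace PME

def gibbs {α : Type*} [MeasurableSpace α] (U : α → ℝ) (m : Measure α) : Measure α :=
  (ENNReal.ofReal (∫ x, Real.exp (-(U x)) ∂m))⁻¹ •
    m.withDensity (fun x => ENNReal.ofReal (Real.exp (-(U x))))

/-- The Dawson fixed-point equation at parameters `β, σ`. -/
def dawsonSol (β σ : ℝ) (ν : Measure ℝ) : Prop :=
  IsProbabilityMeasure ν ∧ Integrable (fun z : ℝ => z ^ 2) ν ∧
  ν = gibbs (fun x : ℝ =>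
      (2 / σ ^ 2) * (x ^ 4 / 4 - x ^ 2 / 2) + (β / σ ^ 2) * ∫ z, (x - z) ^ 2 ∂ν) volume

/-- The explicit symmetric stationary measure `ν_σ`. -/
def nuSigma (β σ : ℝ) : Measure ℝ :=
  gibbs (fun x : ℝ => (2 / σ ^ 2) * (x ^ 4 / 4 - x ^ 2 / 2 + (β / 2) * x ^ 2)) volume

/-- The kinetic (Vlasov--Fokker--Planck) fixed-point equation at parameters `β, σ`,
for probability measures on `ℝ²` whose first marginal has a finite second moment. -/
def kineticSol (β σ : ℝ) (ν : Measure (ℝ × ℝ)) : Prop :=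
  IsProbabilityMeasure ν ∧ Integrable (fun z : ℝ => z ^ 2) (ν.map Prod.fst) ∧
  ν = gibbs (fun p : ℝ × ℝ =>
      (2 / σ ^ 2) * (p.2 ^ 2 / 2 + p.1 ^ 4 / 4 - p.1 ^ 2 / 2) +
        (β / σ ^ 2) * ∫ z, (p.1 - z) ^ 2 ∂(ν.map Prod.fst)) volume

/-- The Gaussian factor `e^{-y²/σ²}/√(πσ²) dy`. -/
def gaussFactor (σ : ℝ) : Measure ℝ :=
  volume.withDensity
    (fun y => ENNReal.ofReal (Real.exp (-(y ^ 2) / σ ^ 2) / Real.sqrt (π * σ ^ 2)))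

/-- The weight `exp(-(a x⁴ + b x²) + t x)`. -/
def wt (a b t x : ℝ) : ℝ := Real.exp (-(a * x ^ 4 + b * x ^ 2) + t * x)

/-- Its moments. -/
def mom (n : ℕ) (a b t : ℝ) : ℝ := ∫ x, x ^ n * wt a b t x

lemma wt_pos (a b t x : ℝ) : 0 < wt a b t x := Real.exp_pos _

lemma wt_cont (a b t : ℝ) : Continuous (wt a b t) := by
  unfold wt; fun_prop

/-- Admissible parameters. -/
def adm (a b t : ℝ) : Prop := ∃ e C : ℝ, 0 < e ∧ ∀ x : ℝ, e * x ^ 2 - C ≤ a * x ^ 4 + b * x ^ 2 - t * x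

lemma adm_quartic {a : ℝ} (b t : ℝ) (ha : 0 < a) : adm a b t := by
  refine ⟨1, (b - 3 / 2) ^ 2 / (4 * a) + t ^ 2 / 2, one_pos, fun x => ?_⟩
  have h1 : 0 ≤ (t - x) ^ 2 := sq_nonneg _
  have h2 : 0 ≤ (2 * a * x ^ 2 + (b - 3 / 2)) ^ 2 / (4 * a) := by positivity
  have h3 : (2 * a * x ^ 2 + (b - 3 / 2)) ^ 2 / (4 * a)
      = a * x ^ 4 + (b - 3 / 2) * x ^ 2 + (b - 3 / 2) ^ 2 / (4 * a) := by
    field_simp; ring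
  nlinarith

lemma adm_gauss {b : ℝ} (hb : 0 < b) : adm 0 b 0 :=
  ⟨b, 0, hb, fun x => by simp⟩

lemma wt_int {a b t : ℝ} (h : adm a b t) (n : ℕ) :
    Integrable (fun x : ℝ => x ^ n * wt a b t x) := by
  obtain ⟨e, C, he, h⟩ := h
  have h1 : Integrable (fun x : ℝ => x ^ n * Real.exp (-e * x ^ 2)) := by
    have := integrable_rpow_mul_exp_neg_mul_sq he (s := (n : ℝ)) (by
      have : (0 : ℝ) ≤ n := Nat.cast_nonneg n
      linarith)
    simpa only [Real.rpow_natCast] using this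
  refine (h1.const_mul (Real.exp C)).mono
    (((continuous_pow n).mul (wt_cont a b t)).aestronglyMeasurable) (ae_of_all _ fun x => ?_)
  have h2 : wt a b t x ≤ Real.exp C * Real.exp (-e * x ^ 2) := by
    rw [← Real.exp_add]
    unfold wt
    apply Real.exp_le_exp.2
    linarith [h x]
  rw [norm_mul, norm_mul, norm_mul, Real.norm_of_nonneg (wt_pos a b t x).le,
    Real.norm_of_nonneg (Real.exp_pos C).le, Real.norm_of_nonneg (Real.exp_pos _).le]
  calc _ ≤ ‖x ^ n‖ * (Real.exp C * Real.exp (-e * x ^ 2)) := by gcongr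
    _ = _ := by ring

lemma wt_int0 {a b t : ℝ} (h : adm a b t) : Integrable (wt a b t) := by
  simpa using wt_int h 0

lemma mom_zero (a b t : ℝ) : mom 0 a b t = ∫ x, wt a b t x := by simp [mom]

lemma mom0_pos {a b t : ℝ} (h : adm a b t) : 0 < mom 0 a b t := by
  rw [mom_zero]
  exact integral_exp_pos (wt_int0 h)

/-- strict positivity of an integral of a continuous nonneg function -/
lemma int_pos {f : ℝ → ℝ} (hf : Continuous f) (hi : Integrable f) (h0 : ∀ x, 0 ≤ f x)
    {x : ℝ} (hx : f x ≠ 0) : 0 < ∫ x, f x := by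
  rw [integral_pos_iff_support_of_nonneg h0 hi]
  exact (hf.isOpen_support).measure_pos _ ⟨x, hx⟩

lemma mom2_pos {a b t : ℝ} (h : adm a b t) : 0 < mom 2 a b t := by
  refine int_pos ((continuous_pow 2).mul (wt_cont a b t)) (wt_int h 2)
    (fun x => mul_nonneg (sq_nonneg x) (wt_pos _ _ _ _).le) (x := 1) ?_
  have hne := (wt_pos a b t 1).ne'
  simpa using hne

/-- integration by parts -/
lemma mom_ibp {a b : ℝ} (h : adm a b 0) (n : ℕ) :
    (n + 1 : ℝ) * mom n a b 0 - 4 * a * mom (n + 4) a b 0 - 2 * b * mom (n + 2) a b 0 = 0 := by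
  have key := integral_eq_zero_of_hasDerivAt_of_integrable
    (f := fun x : ℝ => x ^ (n + 1) * wt a b 0 x)
    (f' := fun x : ℝ => (n + 1 : ℝ) * (x ^ n * wt a b 0 x) - 4 * a * (x ^ (n + 4) * wt a b 0 x)
      - 2 * b * (x ^ (n + 2) * wt a b 0 x)) ?_ ?_ (wt_int h _)
  · rw [integral_sub, integral_sub, integral_const_mul, integral_const_mul, integral_const_mul] at key
    · exact key
    · exact (wt_int h _).const_mul _
    · exact (wt_int h _).const_mul _
    · exact ((wt_int h _).const_mul _).sub ((wt_int h _).const_mul _)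
    · exact (wt_int h _).const_mul _
  · intro x
    have h1 : HasDerivAt (fun x : ℝ => x ^ (n + 1)) (((n + 1 : ℕ) : ℝ) * x ^ n) x := by
      simpa using hasDerivAt_pow (n + 1) x
    have h2 : HasDerivAt (fun x : ℝ => -(a * x ^ 4 + b * x ^ 2) + 0 * x)
        (-(a * (4 * x ^ 3) + b * (2 * x)) + 0) x := by
      have h4 : HasDerivAt (fun x : ℝ => x ^ 4) (4 * x ^ 3) x := by
        simpa using hasDerivAt_pow 4 x
      have h2 : HasDerivAt (fun x : ℝ => x ^ 2) (2 * x) x := by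
        simpa using hasDerivAt_pow 2 x
      have h0 : HasDerivAt (fun x : ℝ => 0 * x) 0 x := by
        simpa using hasDerivAt_const x (0 : ℝ)
      exact (((h4.const_mul a).add (h2.const_mul b)).neg).add h0
    have h3 := h1.mul h2.exp
    refine h3.congr_deriv ?_
    unfold wt
    push_cast
    ring
  · exact (((wt_int h _).const_mul _).sub ((wt_int h _).const_mul _)).sub ((wt_int h _).const_mul _)

/-- Cauchy-Schwarz inequality. -/
lemma mom_cs {a b : ℝ} (h : adm a b 0) :
    mom 2 a b 0 ^ 2 ≤ mom 4 a b 0 * mom 0 a b 0 := by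
  set r := mom 2 a b 0 with hr
  set s := mom 0 a b 0 with hs
  have h0 : 0 < s := mom0_pos h
  have key : 0 ≤ ∫ x, (s * x ^ 2 - r) ^ 2 * wt a b 0 x :=
    integral_nonneg fun x => mul_nonneg (sq_nonneg _) (wt_pos _ _ _ _).le
  have e : (fun x : ℝ => (s * x ^ 2 - r) ^ 2 * wt a b 0 x) = fun x =>
      s ^ 2 * (x ^ 4 * wt a b 0 x) - 2 * s * r * (x ^ 2 * wt a b 0 x)
        + r ^ 2 * (x ^ 0 * wt a b 0 x) := by
    funext x; ring
  have hX : Integrable (fun x : ℝ => s ^ 2 * (x ^ 4 * wt a b 0 x)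
      - 2 * s * r * (x ^ 2 * wt a b 0 x)) :=
    ((wt_int h _).const_mul _).sub ((wt_int h _).const_mul _)
  rw [e, integral_add hX
    ((wt_int h _).const_mul _), integral_sub ((wt_int h _).const_mul _) ((wt_int h _).const_mul _),
    integral_const_mul, integral_const_mul, integral_const_mul] at key
  change 0 ≤ s ^ 2 * mom 4 a b 0 - 2 * s * r * r + r ^ 2 * s at key
  have : 0 ≤ s * (mom 4 a b 0 * s - r ^ 2) := by nlinarith
  have := nonneg_of_mul_nonneg_right this h0
  linarith

/-- Gaussian domination of the fourth moment. -/
lemma mom_gauss {a b : ℝ} (ha : 0 < a) :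
    mom 4 a b 0 * mom 0 a b 0 ≤ 3 * mom 2 a b 0 ^ 2 := by
  have h : adm a b 0 := adm_quartic b 0 ha
  have h0 := mom0_pos h
  have h2 := mom2_pos h
  set d : ℝ := mom 0 a b 0 / (2 * mom 2 a b 0) with hd
  have hdp : 0 < d := by positivity
  have hg := adm_gauss hdp
  have g0 := mom0_pos hg
  set c : ℝ := mom 0 a b 0 / mom 0 0 d 0 with hc
  have hcp : 0 < c := by positivity
  have i0 := mom_ibp hg 0
  have i2 := mom_ibp hg 2
  norm_num at i0 i2
  have c0 : c * mom 0 0 d 0 = mom 0 a b 0 := by rw [hc]; field_simp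
  have hd2 : 2 * d * mom 2 a b 0 = mom 0 a b 0 := by rw [hd]; field_simp
  have c2 : c * mom 2 0 d 0 = mom 2 a b 0 := by
    have : 2 * d * (c * mom 2 0 d 0) = 2 * d * mom 2 a b 0 := by
      rw [hd2, ← c0]; linear_combination (-c) * i0
    exact mul_left_cancel₀ (by positivity) this
  have key : 0 ≤ ∫ x, (wt a b 0 x - c * wt 0 d 0 x) *
      (-(a * x ^ 4 + b * x ^ 2) + d * x ^ 2 - Real.log c) := by
    refine integral_nonneg fun x => ?_
    have e1 : c * wt 0 d 0 x = Real.exp (Real.log c - d * x ^ 2) := by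
      rw [sub_eq_add_neg, Real.exp_add, Real.exp_log hcp]; simp [wt]
    have e2 : wt a b 0 x = Real.exp (-(a * x ^ 4 + b * x ^ 2)) := by simp [wt]
    simp only [Pi.zero_apply]
    rw [e1, e2]
    rcases le_total (-(a * x ^ 4 + b * x ^ 2)) (Real.log c - d * x ^ 2) with hle | hle
    · have := Real.exp_le_exp.2 hle
      apply mul_nonneg_of_nonpos_of_nonpos <;> linarith
    · have := Real.exp_le_exp.2 hle
      apply mul_nonneg <;> linarith
  have e : (fun x : ℝ => (wt a b 0 x - c * wt 0 d 0 x) *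
      (-(a * x ^ 4 + b * x ^ 2) + d * x ^ 2 - Real.log c)) = fun x =>
      (-a) * (x ^ 4 * wt a b 0 x - c * (x ^ 4 * wt 0 d 0 x)) +
      (d - b) * (x ^ 2 * wt a b 0 x - c * (x ^ 2 * wt 0 d 0 x)) +
      (- Real.log c) * (x ^ 0 * wt a b 0 x - c * (x ^ 0 * wt 0 d 0 x)) := by
    funext x; ring
  have hi : ∀ n : ℕ, Integrable fun x : ℝ => x ^ n * wt a b 0 x - c * (x ^ n * wt 0 d 0 x) :=
    fun n => (wt_int h n).sub ((wt_int hg n).const_mul c)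
  have hv : ∀ n : ℕ, ∫ x : ℝ, (x ^ n * wt a b 0 x - c * (x ^ n * wt 0 d 0 x))
      = mom n a b 0 - c * mom n 0 d 0 := by
    intro n
    rw [integral_sub (wt_int h n) ((wt_int hg n).const_mul c), integral_const_mul]
    rfl
  have hX : Integrable (fun x : ℝ => (-a) * (x ^ 4 * wt a b 0 x - c * (x ^ 4 * wt 0 d 0 x)) +
      (d - b) * (x ^ 2 * wt a b 0 x - c * (x ^ 2 * wt 0 d 0 x))) :=
    ((hi 4).const_mul _).add ((hi 2).const_mul _)
  rw [e, integral_add hX ((hi 0).const_mul _),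
    integral_add ((hi 4).const_mul _) ((hi 2).const_mul _),
    integral_const_mul, integral_const_mul, integral_const_mul, hv, hv, hv, c0, c2] at key
  have k4 : mom 4 a b 0 ≤ c * mom 4 0 d 0 := by
    have : 0 ≤ a * (c * mom 4 0 d 0 - mom 4 a b 0) := by linarith
    have := nonneg_of_mul_nonneg_right this ha
    linarith
  have k5 : c * mom 4 0 d 0 * mom 0 a b 0 = 3 * mom 2 a b 0 ^ 2 := by
    have : mom 0 a b 0 * (c * mom 4 0 d 0) = 3 * (mom 2 a b 0) * (c * mom 2 0 d 0) := by
      rw [← hd2]; linear_combination (-c * mom 2 a b 0) * i2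
    rw [c2] at this
    linarith
  nlinarith

/-- symmetrisation -/
lemma int_symm {f : ℝ → ℝ} (hf : Integrable f) :
    2 * ∫ x, f x = ∫ x, (f x + f (-x)) := by
  rw [integral_add hf hf.comp_neg, integral_neg_eq_self]; ring

/-- Monotonicity in the quartic parameter. -/
lemma mom_mono {k₁ k₀ b A : ℝ} (hk1 : 0 < k₁) (hk : k₁ < k₀)
    (hA : mom 2 k₀ b 0 = A * mom 0 k₀ b 0) : A * mom 0 k₁ b 0 < mom 2 k₁ b 0 := by
  have h1 : adm k₁ b 0 := adm_quartic b 0 hk1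
  have h0 : adm k₀ b 0 := adm_quartic b 0 (hk1.trans hk)
  have hApos : 0 < A := by
    have := mom2_pos h0
    rw [hA] at this
    exact pos_of_mul_pos_left this (mom0_pos h0).le
  set lam := Real.exp ((k₀ - k₁) * A ^ 2) with hlam
  have hr : ∀ x, wt k₁ b 0 x = wt k₀ b 0 x * Real.exp ((k₀ - k₁) * (x ^ 2) ^ 2) := by
    intro x
    unfold wt
    rw [← Real.exp_add]; congr 1; ring
  have key : 0 < ∫ x, (x ^ 2 - A) * (wt k₁ b 0 x - lam * wt k₀ b 0 x) := by
    refine int_pos (x := 0) ?_ ?_ ?_ ?_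
    · exact ((continuous_pow 2).sub continuous_const).mul
        ((wt_cont _ _ _).sub (continuous_const.mul (wt_cont _ _ _)))
    · have : (fun x : ℝ => (x ^ 2 - A) * (wt k₁ b 0 x - lam * wt k₀ b 0 x)) = fun x =>
        (x ^ 2 * wt k₁ b 0 x - A * (x ^ 0 * wt k₁ b 0 x))
        - lam * (x ^ 2 * wt k₀ b 0 x - A * (x ^ 0 * wt k₀ b 0 x)) := by funext x; ring
      rw [this]
      exact ((wt_int h1 2).sub ((wt_int h1 0).const_mul A)).sub
        (((wt_int h0 2).sub ((wt_int h0 0).const_mul A)).const_mul _)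
    · intro x
      rw [hr]
      have hw := wt_pos k₀ b 0 x
      have : (x ^ 2 - A) * (wt k₀ b 0 x * Real.exp ((k₀ - k₁) * (x ^ 2) ^ 2) - lam * wt k₀ b 0 x)
        = wt k₀ b 0 x * ((x ^ 2 - A) * (Real.exp ((k₀ - k₁) * (x ^ 2) ^ 2) - lam)) := by ring
      rw [this]
      refine mul_nonneg hw.le ?_
      have hk' : 0 ≤ k₀ - k₁ := by linarith
      rcases le_total (x ^ 2) A with hle | hle
      · have : Real.exp ((k₀ - k₁) * (x ^ 2) ^ 2) ≤ lam := by
          rw [hlam]; gcongr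
        apply mul_nonneg_of_nonpos_of_nonpos <;> linarith
      · have : lam ≤ Real.exp ((k₀ - k₁) * (x ^ 2) ^ 2) := by
          rw [hlam]; gcongr
        apply mul_nonneg <;> linarith
    · have : 1 < lam := by
        rw [hlam]; apply Real.one_lt_exp_iff.2
        have : 0 < k₀ - k₁ := by linarith
        positivity
      simp only [wt]
      norm_num
      constructor
      · exact hApos.ne'
      · linarith
  have e : (fun x : ℝ => (x ^ 2 - A) * (wt k₁ b 0 x - lam * wt k₀ b 0 x)) = fun x =>
        (x ^ 2 * wt k₁ b 0 x - A * (x ^ 0 * wt k₁ b 0 x))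
        - lam * (x ^ 2 * wt k₀ b 0 x - A * (x ^ 0 * wt k₀ b 0 x)) := by funext x; ring
  have hX : Integrable (fun x : ℝ => x ^ 2 * wt k₁ b 0 x - A * (x ^ 0 * wt k₁ b 0 x)) :=
    (wt_int h1 2).sub ((wt_int h1 0).const_mul A)
  have hY : Integrable (fun x : ℝ => x ^ 2 * wt k₀ b 0 x - A * (x ^ 0 * wt k₀ b 0 x)) :=
    (wt_int h0 2).sub ((wt_int h0 0).const_mul A)
  rw [e, integral_sub hX (hY.const_mul _), integral_const_mul,
    integral_sub (wt_int h1 2) ((wt_int h1 0).const_mul A),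
    integral_sub (wt_int h0 2) ((wt_int h0 0).const_mul A), integral_const_mul,
    integral_const_mul] at key
  change 0 < mom 2 k₁ b 0 - A * mom 0 k₁ b 0 - lam * (mom 2 k₀ b 0 - A * mom 0 k₀ b 0) at key
  rw [hA] at key
  linarith

/-- scaling -/
lemma mom_scale {s : ℝ} (hs : 0 < s) (n : ℕ) (a b : ℝ) :
    mom n (s ^ 4 * a) (s ^ 2 * b) 0 * s ^ (n + 1) = mom n a b 0 := by
  have := Measure.integral_comp_mul_left (fun x : ℝ => x ^ n * wt a b 0 x) s
  have e : (fun x : ℝ => (s * x) ^ n * wt a b 0 (s * x)) =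
      fun x => s ^ n * (x ^ n * wt (s ^ 4 * a) (s ^ 2 * b) 0 x) := by
    funext x
    have : wt a b 0 (s * x) = wt (s ^ 4 * a) (s ^ 2 * b) 0 x := by
      unfold wt; congr 1; ring
    rw [this]; ring
  rw [e, integral_const_mul, abs_of_pos (inv_pos.2 hs), smul_eq_mul] at this
  change s ^ n * mom n (s ^ 4 * a) (s ^ 2 * b) 0 = s⁻¹ * mom n a b 0 at this
  rw [pow_succ]
  calc _ = s * (s ^ n * mom n (s ^ 4 * a) (s ^ 2 * b) 0) := by ring
    _ = _ := by rw [this]; field_simp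

/-- the slope is strictly decreasing in `σ` -/
lemma slope_gt {β σ σ0 : ℝ} (hσ : 0 < σ) (hlt : σ < σ0)
    (h : mom 0 (1 / (2 * σ0 ^ 2)) ((β - 1) / σ0 ^ 2) 0
      = (2 * β / σ0 ^ 2) * mom 2 (1 / (2 * σ0 ^ 2)) ((β - 1) / σ0 ^ 2) 0) (hβ : 0 < β) :
    mom 0 (1 / (2 * σ ^ 2)) ((β - 1) / σ ^ 2) 0
      < (2 * β / σ ^ 2) * mom 2 (1 / (2 * σ ^ 2)) ((β - 1) / σ ^ 2) 0 := by
  have sc : ∀ s : ℝ, 0 < s → ∀ n : ℕ, mom n (1 / (2 * s ^ 2)) ((β - 1) / s ^ 2) 0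
      = mom n (s ^ 2 / 2) (β - 1) 0 * s ^ (n + 1) := by
    intro s hs n
    rw [← mom_scale hs n (1 / (2 * s ^ 2))]
    congr 2 <;> field_simp
  have h0 : 0 < σ0 := hσ.trans hlt
  rw [sc _ h0, sc _ h0] at h
  rw [sc _ hσ, sc _ hσ]
  have hA : mom 2 (σ0 ^ 2 / 2) (β - 1) 0 = (1 / (2 * β)) * mom 0 (σ0 ^ 2 / 2) (β - 1) 0 := by
    have e : 2 * β / σ0 ^ 2 * (mom 2 (σ0 ^ 2 / 2) (β - 1) 0 * σ0 ^ (2 + 1)) =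
      (2 * β * mom 2 (σ0 ^ 2 / 2) (β - 1) 0) * σ0 := by field_simp; try ring
    rw [e, zero_add, pow_one] at h
    have h := mul_right_cancel₀ h0.ne' h
    rw [h]
    field_simp
  have := mom_mono (k₁ := σ ^ 2 / 2) (k₀ := σ0 ^ 2 / 2) (by positivity) (by gcongr) hA
  have e : 2 * β / σ ^ 2 * (mom 2 (σ ^ 2 / 2) (β - 1) 0 * σ ^ (2 + 1)) =
    (2 * β * mom 2 (σ ^ 2 / 2) (β - 1) 0) * σ := by field_simp; try ring
  rw [e]
  simp only [zero_add, pow_one]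
  gcongr
  have : 2 * β * (1 / (2 * β) * mom 0 (σ ^ 2 / 2) (β - 1) 0) <
    2 * β * mom 2 (σ ^ 2 / 2) (β - 1) 0 := by gcongr
  have e2 : 2 * β * (1 / (2 * β) * mom 0 (σ ^ 2 / 2) (β - 1) 0) = mom 0 (σ ^ 2 / 2) (β - 1) 0 := by
    field_simp
  linarith

lemma mom_contOn {a : ℝ} (ha : 0 < a) (b κ : ℝ) (n : ℕ) :
    ContinuousOn (fun m : ℝ => mom n a b (κ * m)) (Icc 0 1) := by
  unfold mom
  refine continuousOn_of_dominated (bound := fun x => ‖x ^ n * wt a b 0 x‖ + ‖x ^ n * wt a b κ x‖)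
    ?_ ?_ ?_ ?_
  · intro m _
    exact ((continuous_pow n).mul (wt_cont _ _ _)).aestronglyMeasurable
  · intro m hm
    refine ae_of_all _ fun x => ?_
    rw [norm_mul, norm_mul, norm_mul, Real.norm_of_nonneg (wt_pos _ _ _ x).le,
      Real.norm_of_nonneg (wt_pos _ _ _ x).le, Real.norm_of_nonneg (wt_pos _ _ _ x).le, ← mul_add]
    refine mul_le_mul_of_nonneg_left ?_ (norm_nonneg _)
    rcases le_total 0 (κ * x) with hx | hx
    · have : wt a b (κ * m) x ≤ wt a b κ x := by
        unfold wt; apply Real.exp_le_exp.2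
        nlinarith [hm.1, hm.2]
      linarith [wt_pos a b 0 x]
    · have : wt a b (κ * m) x ≤ wt a b 0 x := by
        unfold wt; apply Real.exp_le_exp.2
        nlinarith [hm.1, hm.2]
      linarith [wt_pos a b κ x]
  · exact (wt_int (adm_quartic b 0 ha) n).norm.add (wt_int (adm_quartic b κ ha) n).norm
  · refine ae_of_all _ fun x => ?_
    unfold wt
    fun_prop

/-- lower bound of the first moment -/
lemma mom1_lower {a : ℝ} (ha : 0 < a) (b : ℝ) {t : ℝ} (ht : 0 ≤ t) :
    t * mom 2 a b 0 ≤ mom 1 a b t := by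
  have hi := wt_int (adm_quartic b t ha) 1
  have h2 := wt_int (adm_quartic b 0 ha) 2
  have s := int_symm hi
  have : ∫ x, 2 * t * (x ^ 2 * wt a b 0 x) ≤
      ∫ x, (x ^ 1 * wt a b t x + (-x) ^ 1 * wt a b t (-x)) := by
    refine integral_mono (h2.const_mul _) (hi.add hi.comp_neg) fun x => ?_
    have e1 : wt a b t x = wt a b 0 x * Real.exp (t * x) := by
      unfold wt; rw [← Real.exp_add]; congr 1; ring
    have e2 : wt a b t (-x) = wt a b 0 x * Real.exp (-(t * x)) := by
      unfold wt; rw [← Real.exp_add]; congr 1; ring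
    have hs := Real.sinh_eq (t * x)
    simp only [e1, e2]
    have e3 : x ^ 1 * (wt a b 0 x * Real.exp (t * x)) + (-x) ^ 1 * (wt a b 0 x * Real.exp (-(t * x)))
      = 2 * (x * Real.sinh (t * x)) * wt a b 0 x := by rw [hs]; ring
    have e4 : 2 * t * (x ^ 2 * wt a b 0 x) = 2 * (x * (t * x)) * wt a b 0 x := by ring
    rw [e3, e4]
    refine mul_le_mul_of_nonneg_right ?_ (wt_pos _ _ _ _).le
    rcases le_total 0 x with hx | hx
    · have := Real.self_le_sinh_iff.2 (mul_nonneg ht hx)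
      nlinarith
    · have := Real.sinh_le_self_iff.2 (mul_nonpos_of_nonneg_of_nonpos ht hx)
      nlinarith
  rw [← s, integral_const_mul] at this
  change 2 * t * mom 2 a b 0 ≤ 2 * mom 1 a b t at this
  linarith

/-- at `m = 1` the mean is at most `1` -/
lemma mom1_upper {β σ : ℝ} (hσ : 0 < σ) :
    mom 1 (1 / (2 * σ ^ 2)) ((β - 1) / σ ^ 2) (2 * β / σ ^ 2) ≤
      mom 0 (1 / (2 * σ ^ 2)) ((β - 1) / σ ^ 2) (2 * β / σ ^ 2) := by
  set a := 1 / (2 * σ ^ 2) with ha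
  set b := (β - 1) / σ ^ 2 with hb
  set t := 2 * β / σ ^ 2 with ht
  have hap : 0 < a := by positivity
  have h := adm_quartic b t hap
  have hi : Integrable (fun x : ℝ => (x - 1) * wt a b t x) := by
    have : (fun x : ℝ => (x - 1) * wt a b t x) = fun x => x ^ 1 * wt a b t x - x ^ 0 * wt a b t x := by
      funext x; ring
    rw [this]; exact (wt_int h 1).sub (wt_int h 0)
  have e : ∫ x, (x - 1) * wt a b t x = mom 1 a b t - mom 0 a b t := by
    unfold mom
    rw [← integral_sub (wt_int h 1) (wt_int h 0)]
    congr 1; funext x; ring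
  have sh := integral_add_right_eq_self (μ := volume) (fun x : ℝ => (x - 1) * wt a b t x) 1
  have hi2 := hi.comp_add_right 1
  have s := int_symm hi2
  rw [sh] at s
  have : ∫ x : ℝ, ((x + 1 - 1) * wt a b t (x + 1) + (-x + 1 - 1) * wt a b t (-x + 1)) ≤ 0 := by
    refine integral_nonpos fun x => ?_
    have d : ∀ y : ℝ, -(a * y ^ 4 + b * y ^ 2) + t * y =
        (-(y ^ 4 / 2 + (β - 1) * y ^ 2) + 2 * β * y) / σ ^ 2 := by
      intro y; rw [ha, hb, ht]; field_simp
    have e3 : (x + 1 - 1) * wt a b t (x + 1) + (-x + 1 - 1) * wt a b t (-x + 1)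
      = x * (wt a b t (x + 1) - wt a b t (-x + 1)) := by ring
    simp only [Pi.zero_apply]
    rw [e3]
    unfold wt
    rw [d, d]
    rcases le_total 0 x with hx | hx
    · refine mul_nonpos_of_nonneg_of_nonpos hx (sub_nonpos.2 (Real.exp_le_exp.2 ?_))
      gcongr ?_ / _
      nlinarith [pow_nonneg hx 3]
    · refine mul_nonpos_of_nonpos_of_nonneg hx (sub_nonneg.2 (Real.exp_le_exp.2 ?_))
      gcongr ?_ / _
      have := pow_nonneg (neg_nonneg.2 hx) 3
      nlinarith
  have : 2 * ∫ x : ℝ, (x - 1) * wt a b t x ≤ 0 := by rw [s]; exact this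
  rw [e] at this
  linarith

/-- existence of a nonzero self-consistent mean -/
lemma exists_mean {β σ : ℝ} (hβ : 0 < β) (hσ : 0 < σ)
    (h : mom 0 (1 / (2 * σ ^ 2)) ((β - 1) / σ ^ 2) 0
      < (2 * β / σ ^ 2) * mom 2 (1 / (2 * σ ^ 2)) ((β - 1) / σ ^ 2) 0) :
    ∃ m : ℝ, 0 < m ∧ mom 1 (1 / (2 * σ ^ 2)) ((β - 1) / σ ^ 2) (2 * β / σ ^ 2 * m) =
      m * mom 0 (1 / (2 * σ ^ 2)) ((β - 1) / σ ^ 2) (2 * β / σ ^ 2 * m) := by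
  have up := mom1_upper (β := β) hσ
  have hap : 0 < 1 / (2 * σ ^ 2) := by positivity
  set a := 1 / (2 * σ ^ 2) with ha
  set b := (β - 1) / σ ^ 2 with hb
  set κ := 2 * β / σ ^ 2 with hκ
  have hκp : 0 < κ := by positivity
  have c0 := mom_contOn hap b κ 0
  have c1 := mom_contOn hap b κ 1
  have hev : ∀ᶠ m in 𝓝[Icc (0 : ℝ) 1] 0, mom 0 a b (κ * m) < κ * mom 2 a b 0 := by
    have := c0 0 (by simp)
    refine this.eventually_lt_const ?_
    simpa using h
  have hev2 : ∀ᶠ m in 𝓝[>] (0 : ℝ), mom 0 a b (κ * m) < κ * mom 2 a b 0 := by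
    have : 𝓝[>] (0 : ℝ) ≤ 𝓝[Icc (0 : ℝ) 1] 0 := by
      rw [← nhdsWithin_Ioc_eq_nhdsGT (zero_lt_one' ℝ)]
      exact nhdsWithin_mono _ Ioc_subset_Icc_self
    exact this hev
  obtain ⟨m0, hm0, hm01⟩ := (hev2.and (Ioo_mem_nhdsGT (zero_lt_one' ℝ))).exists
  have lo := mom1_lower hap b (mul_nonneg hκp.le hm01.1.le)
  have cont : ContinuousOn (fun m => m * mom 0 a b (κ * m) - mom 1 a b (κ * m)) (Icc m0 1) :=
    ((continuousOn_id.mul c0).sub c1).mono (Icc_subset_Icc_left hm01.1.le)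
  obtain ⟨m, hm, hz⟩ := intermediate_value_Icc hm01.2.le cont (show (0 : ℝ) ∈ _ from ⟨by
    have : m0 * mom 0 a b (κ * m0) < m0 * (κ * mom 2 a b 0) := by
      have := hm01.1
      gcongr
    linarith, by
    simp only [mul_one, one_mul]
    linarith⟩)
  exact ⟨m, hm01.1.trans_le hm.1, by linarith⟩

lemma gibbs_prod (U W : ℝ → ℝ) (hU : Measurable U) (hW : Measurable W) :
    gibbs (fun p : ℝ × ℝ => U p.1 + W p.2) volume = (gibbs U volume).prod (gibbs W volume) := by
  unfold gibbs
  have hm1 : Measurable fun x => ENNReal.ofReal (Real.exp (-(U x))) := by fun_prop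
  have hm2 : Measurable fun x => ENNReal.ofReal (Real.exp (-(W x))) := by fun_prop
  rw [Measure.prod_smul_left, Measure.prod_smul_right, prod_withDensity hm1 hm2, smul_smul,
    ← Measure.volume_eq_prod]
  congr 1
  · rw [← ENNReal.mul_inv (Or.inr ENNReal.ofReal_ne_top) (Or.inl ENNReal.ofReal_ne_top),
      ← ENNReal.ofReal_mul (integral_nonneg fun x => (Real.exp_pos _).le),
      ← integral_prod_mul, ← Measure.volume_eq_prod]
    congr 2
    congr 1
    funext p
    rw [← Real.exp_add]; congr 1; ring
  · congr 1
    funext p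
    rw [← ENNReal.ofReal_mul (Real.exp_pos _).le, ← Real.exp_add]; congr 2; ring

lemma gibbs_add_const (U : ℝ → ℝ) (c : ℝ) (hU : Measurable U) :
    gibbs (fun x => U x + c) volume = gibbs U volume := by
  unfold gibbs
  have e : ∀ x, Real.exp (-(U x + c)) = Real.exp (-c) * Real.exp (-(U x)) := by
    intro x; rw [← Real.exp_add]; congr 1; ring
  simp only [e]
  have hm1 : Measurable fun x => ENNReal.ofReal (Real.exp (-(U x))) := by fun_prop
  have hc : ENNReal.ofReal (Real.exp (-c)) ≠ 0 := by
    simpa using Real.exp_pos _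
  have e2 : (fun x => ENNReal.ofReal (Real.exp (-c) * Real.exp (-(U x)))) =
      ENNReal.ofReal (Real.exp (-c)) • fun x => ENNReal.ofReal (Real.exp (-(U x))) := by
    funext x
    rw [ENNReal.ofReal_mul (Real.exp_pos _).le]; rfl
  rw [e2, withDensity_smul _ hm1, smul_smul, integral_const_mul,
    ENNReal.ofReal_mul (Real.exp_pos _).le,
    ENNReal.mul_inv (Or.inr ENNReal.ofReal_ne_top) (Or.inl ENNReal.ofReal_ne_top),
    mul_right_comm, ENNReal.inv_mul_cancel hc ENNReal.ofReal_ne_top, one_mul]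

lemma gauss_eq {σ : ℝ} (hσ : 0 < σ) :
    gaussFactor σ = gibbs (fun y : ℝ => y ^ 2 / σ ^ 2) volume := by
  unfold gaussFactor gibbs
  have hi : ∫ y : ℝ, Real.exp (-(y ^ 2 / σ ^ 2)) = Real.sqrt (π * σ ^ 2) := by
    have := integral_gaussian (1 / σ ^ 2)
    rw [show π / (1 / σ ^ 2) = π * σ ^ 2 by field_simp] at this
    rw [← this]
    congr 1; funext y; congr 1; ring
  have hp : 0 < Real.sqrt (π * σ ^ 2) := by positivity
  rw [hi, ← withDensity_smul _ (by fun_prop)]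
  congr 1
  funext y
  simp only [Pi.smul_apply, smul_eq_mul]
  rw [← ENNReal.ofReal_inv_of_pos hp, ← ENNReal.ofReal_mul (inv_pos.2 hp).le]
  congr 1
  rw [div_eq_inv_mul, neg_div]

lemma gibbs_isProb (U : ℝ → ℝ) (hi : Integrable fun x => Real.exp (-(U x))) :
    IsProbabilityMeasure (gibbs U volume) := by
  constructor
  unfold gibbs
  have hp := integral_exp_pos hi
  rw [Measure.smul_apply, withDensity_apply _ MeasurableSet.univ, Measure.restrict_univ,
    ← ofReal_integral_eq_lintegral_ofReal hi (ae_of_all _ fun x => (Real.exp_pos _).le), smul_eq_mul]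
  exact ENNReal.inv_mul_cancel (by simpa using hp) ENNReal.ofReal_ne_top

lemma gauss_isProb {σ : ℝ} (hσ : 0 < σ) : IsProbabilityMeasure (gaussFactor σ) := by
  rw [gauss_eq hσ]
  apply gibbs_isProb
  have := integrable_exp_neg_mul_sq (b := 1 / σ ^ 2) (by positivity)
  refine this.congr (ae_of_all _ fun x => ?_)
  simp only
  congr 1; ring

lemma gibbs_integral (U f : ℝ → ℝ) (hU : Measurable U) :
    ∫ x, f x ∂(gibbs U volume) =
      (∫ x, Real.exp (-(U x)))⁻¹ * ∫ x, f x * Real.exp (-(U x)) := by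
  unfold gibbs
  rw [integral_smul_measure, integral_withDensity_eq_integral_toReal_smul (by fun_prop)
    (ae_of_all _ fun x => ENNReal.ofReal_lt_top), ENNReal.toReal_inv,
    ENNReal.toReal_ofReal (integral_nonneg fun x => (Real.exp_pos _).le), smul_eq_mul]
  congr 2
  funext x
  rw [ENNReal.toReal_ofReal (Real.exp_pos _).le, smul_eq_mul, mul_comm]

lemma gibbs_integrable (U f : ℝ → ℝ) (hU : Measurable U)
    (hi : Integrable fun x => Real.exp (-(U x)))
    (hf : Integrable fun x => f x * Real.exp (-(U x))) : Integrable f (gibbs U volume) := by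
  unfold gibbs
  have hp := integral_exp_pos hi
  refine Integrable.smul_measure ?_ (by simpa using hp)
  rw [integrable_withDensity_iff (by fun_prop) (ae_of_all _ fun x => ENNReal.ofReal_lt_top)]
  refine hf.congr (ae_of_all _ fun x => ?_)
  simp only
  rw [ENNReal.toReal_ofReal (Real.exp_pos _).le]

lemma dawson_kinetic {β σ : ℝ} (hσ : 0 < σ) {ν : Measure ℝ} (h : dawsonSol β σ ν) :
    kineticSol β σ (ν.prod (gaussFactor σ)) := by
  obtain ⟨hp, hi, he⟩ := h
  have := gauss_isProb hσ
  have hmap : (ν.prod (gaussFactor σ)).map Prod.fst = ν := by simp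
  refine ⟨inferInstance, by rwa [hmap], ?_⟩
  rw [hmap]
  have hz : Integrable (fun z : ℝ => z) ν := by
    refine (hi.add (integrable_const (1 : ℝ))).mono (by fun_prop) (ae_of_all _ fun x => ?_)
    simp only [Pi.add_apply]
    rw [Real.norm_eq_abs, Real.norm_of_nonneg (by positivity)]
    rw [abs_le]; constructor <;> nlinarith
  have hq : ∀ x : ℝ, ∫ z, (x - z) ^ 2 ∂ν = x ^ 2 - 2 * x * (∫ z, z ∂ν) + ∫ z, z ^ 2 ∂ν := by
    intro x
    have e : (fun z : ℝ => (x - z) ^ 2) = fun z => (x ^ 2 - 2 * x * z) + z ^ 2 := by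
      funext z; ring
    have hX : Integrable (fun z : ℝ => x ^ 2 - 2 * x * z) ν :=
      (integrable_const _).sub (hz.const_mul _)
    rw [e, integral_add hX hi, integral_sub (integrable_const _) (hz.const_mul _),
      integral_const_mul]
    simp
  have hmeas : Measurable (fun x : ℝ =>
      (2 / σ ^ 2) * (x ^ 4 / 4 - x ^ 2 / 2) + (β / σ ^ 2) * ∫ z, (x - z) ^ 2 ∂ν) := by
    simp only [hq]; fun_prop
  conv_lhs => rw [he, gauss_eq hσ]
  rw [← gibbs_prod _ _ hmeas (by fun_prop)]
  congr 1
  funext p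
  ring

lemma wt_pot (β m x : ℝ) {σ : ℝ} (hσ : 0 < σ) :
    Real.exp (-(x ^ 4 / (2 * σ ^ 2) + (β - 1) / σ ^ 2 * x ^ 2 - 2 * β / σ ^ 2 * m * x)) =
      wt (1 / (2 * σ ^ 2)) ((β - 1) / σ ^ 2) (2 * β / σ ^ 2 * m) x := by
  unfold wt; congr 1; ring

/-- Reference measure with tilt `m`. -/
def refm (β σ m : ℝ) : Measure ℝ :=
  gibbs (fun x : ℝ => x ^ 4 / (2 * σ ^ 2) + (β - 1) / σ ^ 2 * x ^ 2 - 2 * β / σ ^ 2 * m * x) volume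

lemma refm_integral (β m : ℝ) {σ : ℝ} (hσ : 0 < σ) (n : ℕ) :
    ∫ x, x ^ n ∂(refm β σ m) =
      (mom 0 (1 / (2 * σ ^ 2)) ((β - 1) / σ ^ 2) (2 * β / σ ^ 2 * m))⁻¹ *
       mom n (1 / (2 * σ ^ 2)) ((β - 1) / σ ^ 2) (2 * β / σ ^ 2 * m) := by
  unfold refm
  rw [gibbs_integral _ _ (by fun_prop)]
  simp only [wt_pot β m _ hσ]
  rw [mom_zero]; rfl

lemma refm_zero (β : ℝ) {σ : ℝ} : refm β σ 0 = nuSigma β σ := by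
  unfold refm nuSigma
  congr 1; funext x; ring

lemma refm_isProb (β m : ℝ) {σ : ℝ} (hσ : 0 < σ) : IsProbabilityMeasure (refm β σ m) := by
  apply gibbs_isProb
  simp only [wt_pot β m _ hσ]
  exact wt_int0 (adm_quartic _ _ (by positivity))

lemma refm_integrable (β m : ℝ) {σ : ℝ} (hσ : 0 < σ) (n : ℕ) :
    Integrable (fun x : ℝ => x ^ n) (refm β σ m) := by
  apply gibbs_integrable _ _ (by fun_prop)
  · simp only [wt_pot β m _ hσ]
    exact wt_int0 (adm_quartic _ _ (by positivity))
  · simp only [wt_pot β m _ hσ]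
    exact wt_int (adm_quartic _ _ (by positivity)) n

lemma refm_dawson (β m : ℝ) {σ : ℝ} (hσ : 0 < σ) (hm : ∫ x, x ∂(refm β σ m) = m) :
    dawsonSol β σ (refm β σ m) := by
  have := refm_isProb β m hσ
  refine ⟨inferInstance, refm_integrable β m hσ 2, ?_⟩
  have hi := refm_integrable β m hσ 2
  have hz : Integrable (fun z : ℝ => z) (refm β σ m) := by
    simpa using refm_integrable β m hσ 1
  have hq : ∀ x : ℝ, ∫ z, (x - z) ^ 2 ∂(refm β σ m)
      = x ^ 2 - 2 * x * m + ∫ z, z ^ 2 ∂(refm β σ m) := by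
    intro x
    have e : (fun z : ℝ => (x - z) ^ 2) = fun z => (x ^ 2 - 2 * x * z) + z ^ 2 := by
      funext z; ring
    have hX : Integrable (fun z : ℝ => x ^ 2 - 2 * x * z) (refm β σ m) :=
      (integrable_const _).sub (hz.const_mul _)
    rw [e, integral_add hX hi, integral_sub (integrable_const _) (hz.const_mul _),
      integral_const_mul, hm]
    simp
  simp only [hq]
  set S := ∫ z, z ^ 2 ∂(refm β σ m)
  unfold refm
  rw [← gibbs_add_const _ (β / σ ^ 2 * S) (by fun_prop)]
  congr 1
  funext x
  ring

lemma bif_point {β : ℝ} (hβ : 0 < β) {σ0 : ℝ} (h0 : 0 < σ0)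
    (h : (1 : ℝ) = (2 * β / σ0 ^ 2) * ∫ x, x ^ 2 ∂(nuSigma β σ0)) :
    mom 0 (1 / (2 * σ0 ^ 2)) ((β - 1) / σ0 ^ 2) 0
      = (2 * β / σ0 ^ 2) * mom 2 (1 / (2 * σ0 ^ 2)) ((β - 1) / σ0 ^ 2) 0 := by
  rw [← refm_zero, refm_integral β 0 h0 2, mul_zero] at h
  have := mom0_pos (adm_quartic ((β - 1) / σ0 ^ 2) 0 (show 0 < 1 / (2 * σ0 ^ 2) by positivity))
  set Z := mom 0 (1 / (2 * σ0 ^ 2)) ((β - 1) / σ0 ^ 2) 0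
  generalize mom 2 (1 / (2 * σ0 ^ 2)) ((β - 1) / σ0 ^ 2) 0 = Y at h ⊢
  calc Z = Z * 1 := by ring
    _ = Z * (2 * β / σ0 ^ 2 * (Z⁻¹ * Y)) := by rw [← h]
    _ = _ := by field_simp

lemma range_sigma {β : ℝ} (hβ : 0 < β) {σ : ℝ} (hσ : 0 < σ)
    (h : mom 0 (1 / (2 * σ ^ 2)) ((β - 1) / σ ^ 2) 0
      = (2 * β / σ ^ 2) * mom 2 (1 / (2 * σ ^ 2)) ((β - 1) / σ ^ 2) 0) :
    σ ∈ Icc (Real.sqrt (2 * β / 3)) (Real.sqrt (2 * β)) := by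
  have hap : 0 < 1 / (2 * σ ^ 2) := by positivity
  have ha := adm_quartic ((β - 1) / σ ^ 2) 0 hap
  have cs := mom_cs ha
  have ga := mom_gauss (b := (β - 1) / σ ^ 2) hap
  have ib := mom_ibp ha 0
  have p0 := mom0_pos ha
  have p2 := mom2_pos ha
  norm_num only [Nat.cast_zero, zero_add, one_mul] at ib
  set I0 := mom 0 (1 / (2 * σ ^ 2)) ((β - 1) / σ ^ 2) 0
  set I2 := mom 2 (1 / (2 * σ ^ 2)) ((β - 1) / σ ^ 2) 0
  set I4 := mom 4 (1 / (2 * σ ^ 2)) ((β - 1) / σ ^ 2) 0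
  have h' : σ ^ 2 * I0 = 2 * β * I2 := by rw [h]; field_simp
  have hI4 : I4 = I2 := by
    have : σ ^ 2 * I0 - 2 * I4 - 2 * (β - 1) * I2 = 0 := by
      have := congrArg (fun y => σ ^ 2 * y) ib
      simp only [mul_zero] at this
      rw [← this]; field_simp; ring
    linarith
  rw [hI4] at cs ga
  have h1 : I2 ≤ I0 := by nlinarith
  have h2 : I0 ≤ 3 * I2 := by nlinarith
  constructor
  · apply Real.sqrt_le_iff.2
    refine ⟨hσ.le, ?_⟩
    have : 2 * β / 3 * I0 ≤ σ ^ 2 * I0 := by rw [h']; nlinarith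
    exact le_of_mul_le_mul_right this p0
  · apply Real.le_sqrt_of_sq_le
    have : σ ^ 2 * I0 ≤ 2 * β * I0 := by rw [h']; nlinarith
    exact le_of_mul_le_mul_right this p0

lemma nonprod {β : ℝ} (hβ : 0 < β) {σ : ℝ} (hσ : 0 < σ)
    (h : mom 0 (1 / (2 * σ ^ 2)) ((β - 1) / σ ^ 2) 0
      < (2 * β / σ ^ 2) * mom 2 (1 / (2 * σ ^ 2)) ((β - 1) / σ ^ 2) 0) :
    ∃ μ : Measure (ℝ × ℝ), kineticSol β σ μ ∧ μ ≠ (nuSigma β σ).prod (gaussFactor σ) := by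
  obtain ⟨m, hm, he⟩ := exists_mean hβ hσ h
  have hmean : ∫ x, x ∂(refm β σ m) = m := by
    have := refm_integral β m hσ 1
    simp only [pow_one] at this
    rw [this, he]
    have := mom0_pos (adm_quartic ((β - 1) / σ ^ 2) (2 * β / σ ^ 2 * m)
      (show 0 < 1 / (2 * σ ^ 2) by positivity))
    rw [mul_comm m, inv_mul_cancel_left₀ this.ne']
  have hmean0 : ∫ x, x ∂(nuSigma β σ) = 0 := by
    have := refm_integral β 0 hσ 1
    simp only [pow_one] at this
    rw [← refm_zero, this, mul_zero]
    have hi := wt_int (adm_quartic ((β - 1) / σ ^ 2) 0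
      (show 0 < 1 / (2 * σ ^ 2) by positivity)) 1
    have s := int_symm hi
    have : mom 1 (1 / (2 * σ ^ 2)) ((β - 1) / σ ^ 2) 0 = 0 := by
      have e : ∀ x : ℝ, x ^ 1 * wt (1 / (2 * σ ^ 2)) ((β - 1) / σ ^ 2) 0 x +
          (-x) ^ 1 * wt (1 / (2 * σ ^ 2)) ((β - 1) / σ ^ 2) 0 (-x) = 0 := by
        intro x
        have : wt (1 / (2 * σ ^ 2)) ((β - 1) / σ ^ 2) 0 (-x) =
          wt (1 / (2 * σ ^ 2)) ((β - 1) / σ ^ 2) 0 x := by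
          unfold wt; congr 1; ring
        rw [this]; ring
      simp only [e, integral_zero] at s
      unfold mom
      linarith
    rw [this, mul_zero]
  refine ⟨_, dawson_kinetic hσ (refm_dawson β m hσ hmean), fun hc => ?_⟩
  have := gauss_isProb hσ
  have := congrArg (Measure.map Prod.fst) hc
  simp only [Measure.map_fst_prod, measure_univ, one_smul] at this
  rw [this, hmean0] at hmean
  exact hm.ne hmean

/-- product solutions of the kinetic equation and the bifurcation point. -/
theorem kinetic_bifurcation (β : ℝ) (hβ : 0 < β) :
    (∀ σ : ℝ, 0 < σ → ∀ ν₁ : Measure ℝ, dawsonSol β σ ν₁ →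
      kineticSol β σ (ν₁.prod (gaussFactor σ))) ∧
    (∀ σ0 : ℝ, 0 < σ0 →
      (1 : ℝ) = (2 * β / σ0 ^ 2) * ∫ x, x ^ 2 ∂(nuSigma β σ0) →
      σ0 ∈ Icc (Real.sqrt (2 * β / 3)) (Real.sqrt (2 * β)) ∧
      ∀ δ' : ℝ, 0 < δ' → ∃ σ : ℝ, σ ∈ Ioo (σ0 - δ') (σ0 + δ') ∧
        ∃ μ : Measure (ℝ × ℝ), kineticSol β σ μ ∧
          μ ≠ (nuSigma β σ).prod (gaussFactor σ)) := by
  refine ⟨fun σ hσ ν₁ h => dawson_kinetic hσ h, fun σ0 h0 h => ?_⟩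
  have hb := bif_point hβ h0 h
  refine ⟨range_sigma hβ h0 hb, fun δ' hδ => ?_⟩
  obtain ⟨σ, hl, hu⟩ := exists_between (show max 0 (σ0 - δ') < σ0 from max_lt h0 (by linarith))
  have hσ : 0 < σ := (le_max_left _ _).trans_lt hl
  exact ⟨σ, ⟨(le_max_right _ _).trans_lt hl, by linarith⟩, nonprod hβ hσ (slope_gt hσ hu hb hβ)⟩

end PME
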